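/- arXiv:1607.01263 — 5 statements merged into one kernel-verified Lean document; each statement's English description precedes it below -/
import Mathlib

section
/- Let F be a field and L ⊆ F^n a subspace. Then the dual of the rank support space V_L under the trace product is again a rank support space; more concretely, (V_L)^⊥ = V_{L^⊥}, where L^⊥ is the orthogonal of L under the standard bilinear form on F^n. -/
noncomputable section

open Matrix

variable {F : Type*} [Field F]

/-- The row space of a matrix: the span of its rows. -/
def rowSpace {m n : ℕ} (C : Matrix (Fin m) (Fin n) F) : Submodule F (Fin n → F) :=
  Submodule.span F (Set.range C)

/-- The rank support space of a subspace `L ⊆ F^n`: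
all `m × n` matrices whose row space is contained in `L`. -/
def rss (m : ℕ) {n : ℕ} (L : Submodule F (Fin n → F)) :
    Submodule F (Matrix (Fin m) (Fin n) F) where
  carrier := {V | rowSpace V ≤ L}
  add_mem' := by
    intro a b ha hb
    simp only [Set.mem_setOf_eq, rowSpace, Submodule.span_le] at *
    rintro x ⟨i, rfl⟩
    exact L.add_mem (ha (Set.mem_range_self i)) (hb (Set.mem_range_self i))
  zero_mem' := by
    simp only [Set.mem_setOf_eq, rowSpace, Submodule.span_le]
    rintro x ⟨i, rfl⟩
    exact L.zero_mem
  smul_mem' := by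
    intro c a ha
    simp only [Set.mem_setOf_eq, rowSpace, Submodule.span_le] at *
    rintro x ⟨i, rfl⟩
    exact L.smul_mem c (ha (Set.mem_range_self i))

/-- A rank support space in `F^{m×n}` is any subspace of the form `rss m L`. -/
def IsRSS {m n : ℕ} (V : Submodule F (Matrix (Fin m) (Fin n) F)) : Prop :=
  ∃ L : Submodule F (Fin n → F), V = rss m L

/-- The dual of a space of matrices under the trace (Hilbert–Schmidt) product
`⟨C, D⟩ = Trace (C * Dᵀ)`. -/
def traceDual {m n : ℕ} (C : Submodule F (Matrix (Fin m) (Fin n) F)) :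
    Submodule F (Matrix (Fin m) (Fin n) F) where
  carrier := {D | ∀ C' ∈ C, Matrix.trace (C' * D.transpose) = 0}
  add_mem' := by
    intro a b ha hb C' hC'
    simp [Matrix.transpose_add, Matrix.mul_add, Matrix.trace_add, ha C' hC', hb C' hC']
  zero_mem' := by
    intro C' hC'
    simp
  smul_mem' := by
    intro c a ha C' hC'
    simp [Matrix.transpose_smul, Matrix.mul_smul, Matrix.trace_smul, ha C' hC']

/-- The orthogonal of a subspace of `F^n` under the standard bilinear form. -/
def dualL {n : ℕ} (L : Submodule F (Fin n → F)) : Submodule F (Fin n → F) where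
  carrier := {w | ∀ v ∈ L, ∑ i, v i * w i = 0}
  add_mem' := by
    intro a b ha hb v hv
    have : ∑ i, v i * (a + b) i = (∑ i, v i * a i) + ∑ i, v i * b i := by
      rw [← Finset.sum_add_distrib]
      exact Finset.sum_congr rfl fun i _ => mul_add _ _ _
    rw [this, ha v hv, hb v hv, add_zero]
  zero_mem' := by
    intro v hv
    simp
  smul_mem' := by
    intro c a ha v hv
    have : ∑ i, v i * (c • a) i = c * ∑ i, v i * a i := by
      rw [Finset.mul_sum]
      exact Finset.sum_congr rfl fun i _ => by simp [Pi.smul_apply, smul_eq_mul]; ring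
    rw [this, ha v hv, mul_zero]

theorem mem_rss_iff {m n : ℕ} {L : Submodule F (Fin n → F)} {V : Matrix (Fin m) (Fin n) F} :
    V ∈ rss m L ↔ ∀ i, V i ∈ L :=
  Submodule.span_le.trans Set.range_subset_iff

theorem trace_mul_transpose_eq_sum {m n : ℕ} (C D : Matrix (Fin m) (Fin n) F) :
    (C * Dᵀ).trace = ∑ i, ∑ j, C i j * D i j := by
  simp only [trace, diag_apply, mul_apply, transpose_apply]

theorem traceDual_rss (m : ℕ) {n : ℕ} (L : Submodule F (Fin n → F)) :
    traceDual (rss m L) = rss m (dualL L) := by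
  ext D
  rw [mem_rss_iff]
  constructor
  · intro hD i v hv
    have hmem : Matrix.updateRow 0 i v ∈ rss m L := mem_rss_iff.2 fun k => by
      rcases eq_or_ne k i with rfl | hk
      · rwa [updateRow_self]
      · rw [updateRow_ne hk]
        exact L.zero_mem
    have htrace := hD _ hmem
    rw [trace_mul_transpose_eq_sum, Finset.sum_eq_single i] at htrace
    · simpa only [updateRow_self] using htrace
    · intro k _ hk
      simp [updateRow_ne hk]
    · simp
  · intro hD C hC
    rw [trace_mul_transpose_eq_sum]
    exact Finset.sum_eq_zero fun i _ => hD i (C i) (mem_rss_iff.1 hC i)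

/-- The dual of a rank support space under the trace product is again a rank
support space; concretely, `(V_L)^⊥ = V_{L^⊥}`. -/
theorem stmt_2 (m n : ℕ) (L : Submodule F (Fin n → F)) :
    IsRSS (traceDual (rss m L)) ∧ traceDual (rss m L) = rss m (dualL L) := by
  exact ⟨⟨dualL L, traceDual_rss m L⟩, traceDual_rss m L⟩

end
end

section
/- Let F be a field and C₂ ⊊ C₁ ⊆ F^{m×n} nested linear codes, and let 1 ≤ r ≤ dim(C₁/C₂). Then d_{M,r}(C₁,C₂) = min{ wt_R(D) : D ⊆ C₁ a subspace with D ∩ C₂ = {0} and dim(D) = r }. In particular, d_{M,1}(C₁,C₂) = min{ Rk(C) : C ∈ C₁, C ∉ C₂ }, the minimum rank distance of the pair. -/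
noncomputable section

open Matrix

variable {F : Type*} [Field F]

/-- The rank of a matrix, as the dimension of its row space. -/
def Rk {m n : ℕ} (C : Matrix (Fin m) (Fin n) F) : ℕ :=
  Module.finrank F (rowSpace C)

/-- The rank support of a subspace of matrices: the sum of the row spaces of its elements. -/
def RSupp {m n : ℕ} (D : Submodule F (Matrix (Fin m) (Fin n) F)) : Submodule F (Fin n → F) :=
  ⨆ C : D, rowSpace (C : Matrix (Fin m) (Fin n) F)

/-- The rank weight of a subspace of matrices. -/
def wtR {m n : ℕ} (D : Submodule F (Matrix (Fin m) (Fin n) F)) : ℕ :=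
  Module.finrank F (RSupp D)

/-- The `r`-th relative generalized matrix weight of a pair of nested linear codes. -/
def dM {m n : ℕ} (C₁ C₂ : Submodule F (Matrix (Fin m) (Fin n) F)) (r : ℕ) : ℕ :=
  sInf { d | ∃ L : Submodule F (Fin n → F), Module.finrank F L = d ∧
    Module.finrank F ↥(C₁ ⊓ rss m L) - Module.finrank F ↥(C₂ ⊓ rss m L) ≥ r }

theorem mem_rss {m n : ℕ} {L : Submodule F (Fin n → F)} {V : Matrix (Fin m) (Fin n) F} :
    V ∈ rss m L ↔ rowSpace V ≤ L :=
  Iff.rfl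

theorem RSupp_le_iff {m n : ℕ} {D : Submodule F (Matrix (Fin m) (Fin n) F)}
    {L : Submodule F (Fin n → F)} : RSupp D ≤ L ↔ D ≤ rss m L := by
  simp only [RSupp, iSup_le_iff, Subtype.forall]
  rfl

theorem RSupp_span_singleton {m n : ℕ} (C : Matrix (Fin m) (Fin n) F) :
    RSupp (F ∙ C) = rowSpace C :=
  eq_of_forall_ge_iff fun L => by
    rw [RSupp_le_iff, Submodule.span_singleton_le_iff_mem, mem_rss]

theorem wtR_span_singleton {m n : ℕ} (C : Matrix (Fin m) (Fin n) F) :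
    wtR (F ∙ C) = Rk C := by
  rw [wtR, RSupp_span_singleton, Rk]

theorem Submodule.exists_le_finrank_eq {V : Type*} [AddCommGroup V] [Module F V]
    [FiniteDimensional F V] {B : Submodule F V} {r : ℕ} (h : r ≤ Module.finrank F B) :
    ∃ D ≤ B, Module.finrank F D = r := by
  obtain ⟨f, hf⟩ := exists_linearIndependent_of_le_finrank h
  refine ⟨(Submodule.span F (Set.range f)).map B.subtype, Submodule.map_subtype_le _ _, ?_⟩
  rw [Submodule.finrank_map_subtype_eq, finrank_span_eq_card hf, Fintype.card_fin]

theorem Submodule.le_finrank_sub_finrank_iff {V : Type*} [AddCommGroup V] [Module F V]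
    [FiniteDimensional F V] {A B : Submodule F V} (hAB : A ≤ B) (r : ℕ) :
    r ≤ Module.finrank F B - Module.finrank F A ↔
      ∃ D ≤ B, D ⊓ A = ⊥ ∧ Module.finrank F D = r := by
  constructor
  · intro hr
    obtain ⟨E, hE, hsup⟩ := IsModularLattice.exists_disjoint_and_sup_eq hAB
    have hdim := Submodule.finrank_sup_add_finrank_inf_eq A E
    rw [hsup, hE.eq_bot, finrank_bot] at hdim
    obtain ⟨D, hDE, hD⟩ := Submodule.exists_le_finrank_eq (B := E) (r := r) (by omega)
    exact ⟨D, hDE.trans (hsup ▸ le_sup_right), (hE.symm.mono_left hDE).eq_bot, hD⟩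
  · rintro ⟨D, hDB, hDA, rfl⟩
    have hdim := Submodule.finrank_sup_add_finrank_inf_eq D A
    rw [hDA, finrank_bot] at hdim
    have := Submodule.finrank_mono (sup_le hDB hAB)
    omega

theorem Nat.sInf_eq_of_subset_of_forall_exists_le {S T : Set ℕ} (hTS : T ⊆ S)
    (h : ∀ s ∈ S, ∃ t ∈ T, t ≤ s) : sInf S = sInf T := by
  rcases S.eq_empty_or_nonempty with rfl | hS
  · rw [Set.subset_empty_iff.mp hTS]
  · obtain ⟨t, ht, hle⟩ := h _ (Nat.sInf_mem hS)
    exact le_antisymm (Nat.sInf_le (hTS (Nat.sInf_mem ⟨t, ht⟩))) ((Nat.sInf_le ht).trans hle)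

theorem dM_eq_sInf_wtR {m n : ℕ} {C₁ C₂ : Submodule F (Matrix (Fin m) (Fin n) F)}
    (h21 : C₂ ≤ C₁) (r : ℕ) :
    dM C₁ C₂ r = sInf { w | ∃ D : Submodule F (Matrix (Fin m) (Fin n) F),
        D ≤ C₁ ∧ D ⊓ C₂ = ⊥ ∧ Module.finrank F ↥D = r ∧ w = wtR D } := by
  refine Nat.sInf_eq_of_subset_of_forall_exists_le ?_ ?_
  · rintro _ ⟨D, hD1, hD2, hr, rfl⟩
    refine ⟨RSupp D, rfl, (Submodule.le_finrank_sub_finrank_iff (inf_le_inf_right _ h21) r).2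
      ⟨D, le_inf hD1 (RSupp_le_iff.1 le_rfl), ?_, hr⟩⟩
    rw [← inf_assoc, hD2, bot_inf_eq]
  · rintro _ ⟨L, rfl, hL⟩
    obtain ⟨D, hD1, hD2, hr⟩ :=
      (Submodule.le_finrank_sub_finrank_iff (inf_le_inf_right _ h21) r).1 hL
    obtain ⟨hDC, hDL⟩ := le_inf_iff.1 hD1
    refine ⟨_, ⟨D, hDC, ?_, hr, rfl⟩, Submodule.finrank_mono (RSupp_le_iff.2 hDL)⟩
    rwa [inf_comm C₂, ← inf_assoc, inf_eq_left.2 hDL] at hD2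

theorem exists_finrank_one_wtR_iff {m n : ℕ} {C₁ C₂ : Submodule F (Matrix (Fin m) (Fin n) F)}
    (k : ℕ) :
    (∃ D : Submodule F (Matrix (Fin m) (Fin n) F),
        D ≤ C₁ ∧ D ⊓ C₂ = ⊥ ∧ Module.finrank F ↥D = 1 ∧ k = wtR D) ↔
      ∃ C ∈ C₁, C ∉ C₂ ∧ k = Rk C := by
  constructor
  · rintro ⟨D, hD1, hD2, hr, rfl⟩
    obtain ⟨C, hC, hC0, rfl⟩ : ∃ C ∈ D, C ≠ 0 ∧ D = F ∙ C := by
      have hD : D ≠ ⊥ := by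
        rintro rfl
        simp at hr
      obtain ⟨C, hC, hC0⟩ := D.exists_mem_ne_zero_of_ne_bot hD
      refine ⟨C, hC, hC0, (Submodule.eq_of_le_of_finrank_eq ?_ ?_).symm⟩
      · rwa [Submodule.span_singleton_le_iff_mem]
      · rw [finrank_span_singleton hC0, hr]
    refine ⟨C, hD1 hC, fun hC2 => hC0 ?_, wtR_span_singleton C⟩
    exact (Submodule.mem_bot F).1 (hD2 ▸ Submodule.mem_inf.2 ⟨hC, hC2⟩)
  · rintro ⟨C, hC1, hC2, rfl⟩
    have hC0 : C ≠ 0 := fun h => hC2 (h ▸ C₂.zero_mem)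
    refine ⟨F ∙ C, (Submodule.span_singleton_le_iff_mem _ _).2 hC1, ?_,
      finrank_span_singleton hC0, (wtR_span_singleton C).symm⟩
    exact ((Submodule.disjoint_span_singleton' hC0).2 hC2).symm.eq_bot

/-- The `r`-th relative generalized matrix weight equals the minimum rank weight
of an `r`-dimensional subspace `D ⊆ C₁` with `D ∩ C₂ = 0`; in particular the first one is the
minimum rank distance `min {Rk C : C ∈ C₁, C ∉ C₂}` of the pair. -/
theorem stmt_3 (m n : ℕ) (C₁ C₂ : Submodule F (Matrix (Fin m) (Fin n) F))
    (h21 : C₂ ≤ C₁) (hne : C₂ ≠ C₁) (r : ℕ) (hr1 : 1 ≤ r)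
    (hr2 : r ≤ Module.finrank F ↥C₁ - Module.finrank F ↥C₂) :
    dM C₁ C₂ r = sInf { w | ∃ D : Submodule F (Matrix (Fin m) (Fin n) F),
        D ≤ C₁ ∧ D ⊓ C₂ = ⊥ ∧ Module.finrank F ↥D = r ∧ w = wtR D } ∧
    dM C₁ C₂ 1 = sInf { k | ∃ C ∈ C₁, C ∉ C₂ ∧ k = Rk C } := by
  refine ⟨dM_eq_sInf_wtR h21 r, ?_⟩
  rw [dM_eq_sInf_wtR h21 1]
  congr 1
  ext k
  exact exists_finrank_one_wtR_iff k

end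
end

section
/- Let q be a prime power and C₂ ⊊ C₁ ⊆ F_q^{m×n} nested linear codes with ℓ = dim(C₁/C₂). Let W be a subspace with C₁ = C₂ ⊕ W and ψ : F_q^ℓ → W a vector space isomorphism. Let x be uniformly distributed on F_q^ℓ and, conditioned on x, let C be uniformly distributed on the coset ψ(x) + C₂. Let B ∈ F_q^{μ×n} and L = Row(B) ⊆ F_q^n. Then the mutual information between x and CBᵀ, measured in q-ary units (i.e., Shannon mutual information divided by log q), equals dim(C₂^⊥ ∩ V_L) − dim(C₁^⊥ ∩ V_L). -/
noncomputable section

open Matrix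

variable {F : Type*} [Field F]

/-- Shannon entropy (in nats) of a random variable `Y` defined on a finite sample space `Ω`
equipped with the uniform probability distribution. -/
def entropy {Ω β : Type*} [Finite Ω] [Fintype β] (Y : Ω → β) : ℝ :=
  -∑ y : β, ((Nat.card {ω : Ω // Y ω = y} : ℝ) / (Nat.card Ω : ℝ)) *
      Real.log ((Nat.card {ω : Ω // Y ω = y} : ℝ) / (Nat.card Ω : ℝ))

/-- Mutual information `I(X; Y) = H(Y) - H(Y|X) = H(X) + H(Y) - H(X, Y)` of two random
variables on a finite sample space `Ω` equipped with the uniform probability distribution. -/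
def mutualInfo {Ω β γ : Type*} [Finite Ω] [Fintype β] [Fintype γ]
    (X : Ω → β) (Y : Ω → γ) : ℝ :=
  entropy X + entropy Y - entropy (fun ω => (X ω, Y ω))

/-- The entropy (in nats) of a linear map out of a finite vector space is its rank times the
entropy of the scalar field. -/
theorem entropy_linearMap [Fintype F] {V U : Type*} [AddCommGroup V] [Module F V] [Finite V]
    [AddCommGroup U] [Module F U] [Fintype U] (T : V →ₗ[F] U) :
    entropy T = (Module.finrank F (LinearMap.range T) : ℝ) * Real.log (Fintype.card F) := by
  classical
  have hfiber (y : U) (hy : y ∈ LinearMap.range T) :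
      Nat.card {v : V // T v = y} = Nat.card (LinearMap.ker T) := by
    obtain ⟨v, rfl⟩ := hy
    exact Nat.card_congr (T.toAddMonoidHom.fiberEquivKer v)
  have hV : Nat.card V = Nat.card (LinearMap.ker T) * Nat.card (LinearMap.range T) := by
    rw [Submodule.card_eq_card_quotient_mul_card (LinearMap.ker T),
      Nat.card_congr T.quotKerEquivRange.toEquiv]
  have hK : (Nat.card (LinearMap.ker T) : ℝ) ≠ 0 := by exact_mod_cast Nat.card_pos.ne'
  have hR : (Nat.card (LinearMap.range T) : ℝ) ≠ 0 := by exact_mod_cast Nat.card_pos.ne'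
  have hterm (y : U) : ((Nat.card {v : V // T v = y} : ℝ) / (Nat.card V : ℝ)) *
      Real.log ((Nat.card {v : V // T v = y} : ℝ) / (Nat.card V : ℝ)) =
      if y ∈ LinearMap.range T then
        (Nat.card (LinearMap.range T) : ℝ)⁻¹ * Real.log (Nat.card (LinearMap.range T) : ℝ)⁻¹
      else 0 := by
    split_ifs with hy
    · rw [hfiber y hy, hV, Nat.cast_mul, ← div_div, div_self hK, one_div]
    · have : IsEmpty {v : V // T v = y} := ⟨fun v => hy ⟨v.1, v.2⟩⟩
      simp
  have hcard : (Finset.univ.filter (· ∈ LinearMap.range T)).card =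
      Nat.card (LinearMap.range T) := by
    rw [← Fintype.card_subtype, Nat.card_eq_fintype_card]
  rw [entropy, Finset.sum_congr rfl fun y _ => hterm y, ← Finset.sum_filter, Finset.sum_const,
    hcard, nsmul_eq_mul, mul_inv_cancel_left₀ hR, Real.log_inv, neg_neg,
    Module.natCard_eq_pow_finrank (K := F), Nat.cast_pow, Real.log_pow, Nat.card_eq_fintype_card]

/-- The trace product `⟨C, D⟩ = Trace (C * Dᵀ)` as a bilinear form. -/
def traceProduct (F : Type*) [Field F] (m n : ℕ) :
    LinearMap.BilinForm F (Matrix (Fin m) (Fin n) F) :=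
  LinearMap.mk₂ F (fun C D => (C * Dᵀ).trace)
    (fun _ _ _ => by simp [Matrix.add_mul])
    (fun _ _ _ => by simp)
    (fun _ _ _ => by simp [Matrix.mul_add])
    (fun _ _ _ => by simp)

theorem nondegenerate_traceProduct (m n : ℕ) : (traceProduct F m n).Nondegenerate := by
  constructor
  · intro C hC
    refine Matrix.ext_iff_trace_mul_right.2 fun X => ?_
    simpa [traceProduct] using hC Xᵀ
  · intro D hD
    rw [← Matrix.transpose_eq_zero]
    refine Matrix.ext_iff_trace_mul_left.2 fun X => ?_
    simpa [traceProduct] using hD X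

theorem finrank_add_finrank_traceDual {m n : ℕ}
    (C : Submodule F (Matrix (Fin m) (Fin n) F)) :
    Module.finrank F C + Module.finrank F (traceDual C) = m * n := by
  have hdual : traceDual C = (traceProduct F m n).orthogonal C := rfl
  have h := (traceProduct F m n).finrank_add_finrank_orthogonal' C
  rw [(nondegenerate_traceProduct m n).ker_eq_bot, inf_bot_eq, finrank_bot, add_zero,
    Module.finrank_matrix, Module.finrank_self] at h
  rw [hdual]
  simpa using h

theorem rss_rowSpace (m : ℕ) {k n : ℕ} (B : Matrix (Fin k) (Fin n) F) :
    rss m (rowSpace B) = LinearMap.range (mulRightLinearMap (Fin m) F B) := by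
  ext V
  have hrow : rowSpace B = LinearMap.range B.vecMulLinear := by
    rw [range_vecMulLinear]; rfl
  change rowSpace V ≤ rowSpace B ↔ _
  rw [hrow, rowSpace, Submodule.span_le]
  refine Set.range_subset_iff.trans ?_
  simp only [SetLike.mem_coe, LinearMap.mem_range, mulRightLinearMap_apply]
  constructor
  · intro h
    choose D hD using h
    exact ⟨Matrix.of D, by ext i j; exact congrFun (hD i) j⟩
  · rintro ⟨D, rfl⟩ i
    exact ⟨D i, rfl⟩

theorem comap_mulRight_traceDual {m k n : ℕ} (C : Submodule F (Matrix (Fin m) (Fin n) F))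
    (B : Matrix (Fin k) (Fin n) F) :
    (traceDual C).comap (mulRightLinearMap (Fin m) F B) =
      traceDual (C.map (mulRightLinearMap (Fin m) F Bᵀ)) := by
  ext D
  change (∀ C' ∈ C, (C' * (D * B)ᵀ).trace = 0) ↔
    ∀ E ∈ C.map (mulRightLinearMap (Fin m) F Bᵀ), (E * Dᵀ).trace = 0
  simp [Matrix.transpose_mul, Matrix.mul_assoc]

/-- The image of a code under right multiplication by `Bᵀ` has dimension
`dim V_L - dim (C^⊥ ∩ V_L)`, where `L` is the row space of `B`. -/
theorem finrank_map_mulRight_add_finrank_traceDual_inf_rss {m k n : ℕ}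
    (C : Submodule F (Matrix (Fin m) (Fin n) F)) (B : Matrix (Fin k) (Fin n) F) :
    Module.finrank F (C.map (mulRightLinearMap (Fin m) F Bᵀ)) +
        Module.finrank F ↥(traceDual C ⊓ rss m (rowSpace B)) =
      Module.finrank F (rss m (rowSpace B)) := by
  set A := mulRightLinearMap (Fin m) F B with hA
  have hker : LinearMap.ker A ≤ (traceDual C).comap A := LinearMap.ker_le_comap A
  have h₁ := (A.domRestrict ((traceDual C).comap A)).finrank_range_add_finrank_ker
  rw [LinearMap.range_domRestrict, Submodule.map_comap_eq, LinearMap.ker_domRestrict,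
    (Submodule.comapSubtypeEquivOfLe hker).finrank_eq, comap_mulRight_traceDual] at h₁
  have h₂ := A.finrank_range_add_finrank_ker
  rw [Module.finrank_matrix, Module.finrank_self, Fintype.card_fin, Fintype.card_fin] at h₂
  have h₃ := finrank_add_finrank_traceDual (C.map (mulRightLinearMap (Fin m) F Bᵀ))
  rw [rss_rowSpace, ← hA, inf_comm]
  lia

/-- The rank of `(x, d) ↦ (x, g x + h d)` is `dim V + rank h`. -/
theorem finrank_range_fst_prod_coprod {V V' U : Type*} [AddCommGroup V] [Module F V]
    [FiniteDimensional F V] [AddCommGroup V'] [Module F V'] [FiniteDimensional F V']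
    [AddCommGroup U] [Module F U] (g : V →ₗ[F] U) (h : V' →ₗ[F] U) :
    Module.finrank F (LinearMap.range ((LinearMap.fst F V V').prod (g.coprod h))) =
      Module.finrank F V + Module.finrank F (LinearMap.range h) := by
  have hker : LinearMap.ker ((LinearMap.fst F V V').prod (g.coprod h)) =
      (LinearMap.ker h).map (LinearMap.inr F V V') := by
    ext ⟨x, d⟩
    simp only [LinearMap.mem_ker, LinearMap.prod_apply, Function.prod, LinearMap.fst_apply,
      LinearMap.coprod_apply, Prod.mk_eq_zero, Submodule.mem_map, LinearMap.inr_apply,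
      Prod.mk.injEq]
    constructor
    · rintro ⟨rfl, hd⟩
      exact ⟨d, by simpa using hd, rfl, rfl⟩
    · rintro ⟨e, he, rfl, rfl⟩
      exact ⟨rfl, by simpa using he⟩
  have h₁ := ((LinearMap.fst F V V').prod (g.coprod h)).finrank_range_add_finrank_ker
  rw [hker, ← ((LinearMap.ker h).equivMapOfInjective _ LinearMap.inr_injective).finrank_eq,
    Module.finrank_prod] at h₁
  have h₂ := h.finrank_range_add_finrank_ker
  lia

/-- Worst-case information leakage: for the coset coding scheme built from a
nested linear code pair `C₂ ⊊ C₁ ⊆ F_q^{m×n}` via `C₁ = C₂ ⊕ W` and `ψ : F_q^ℓ ≃ W`, where the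
message `x` is uniform on `F_q^ℓ` and, given `x`, the transmitted matrix `C = ψ x + d` is uniform
on the coset `ψ x + C₂` (i.e. `(x, d)` is uniform on `F_q^ℓ × C₂`), the mutual information between
`x` and the wiretapper observation `C Bᵀ` equals
`(dim(C₂^⊥ ∩ V_L) - dim(C₁^⊥ ∩ V_L)) · log q`, where `L = Row(B)`. -/
theorem stmt_6 (q : ℕ) (hq : IsPrimePow q) (F : Type*) [Field F] [Fintype F] [DecidableEq F]
    (hFq : Fintype.card F = q) (m n : ℕ)
    (C₁ C₂ : Submodule F (Matrix (Fin m) (Fin n) F)) (h21 : C₂ ≤ C₁) (hne : C₂ ≠ C₁)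
    (ℓ : ℕ) (hℓ : ℓ = Module.finrank F ↥C₁ - Module.finrank F ↥C₂)
    (W : Submodule F (Matrix (Fin m) (Fin n) F)) (hWinf : C₂ ⊓ W = ⊥) (hWsup : C₂ ⊔ W = C₁)
    (ψ : (Fin ℓ → F) ≃ₗ[F] W)
    (μ : ℕ) (B : Matrix (Fin μ) (Fin n) F)
    (L : Submodule F (Fin n → F)) (hLB : L = rowSpace B) :
    mutualInfo
      (fun ω : (Fin ℓ → F) × C₂ => ω.1)
      (fun ω : (Fin ℓ → F) × C₂ =>
        ((ψ ω.1 : Matrix (Fin m) (Fin n) F) + (ω.2 : Matrix (Fin m) (Fin n) F)) * Bᵀ)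
      = ((Module.finrank F ↥(traceDual C₂ ⊓ rss m L) : ℝ)
          - (Module.finrank F ↥(traceDual C₁ ⊓ rss m L) : ℝ)) * Real.log q := by
  subst hLB hFq
  let R := mulRightLinearMap (Fin m) F Bᵀ
  let g : (Fin ℓ → F) →ₗ[F] Matrix (Fin m) (Fin μ) F := R ∘ₗ W.subtype ∘ₗ ψ.toLinearMap
  let h : C₂ →ₗ[F] Matrix (Fin m) (Fin μ) F := R ∘ₗ C₂.subtype
  have hY : (fun ω : (Fin ℓ → F) × C₂ =>
      ((ψ ω.1 : Matrix (Fin m) (Fin n) F) + (ω.2 : Matrix (Fin m) (Fin n) F)) * Bᵀ) =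
      g.coprod h := by
    ext1 ω
    simp [g, h, R, Matrix.add_mul]
  have hXY : (fun ω : (Fin ℓ → F) × C₂ => (ω.1,
      ((ψ ω.1 : Matrix (Fin m) (Fin n) F) + (ω.2 : Matrix (Fin m) (Fin n) F)) * Bᵀ)) =
      (LinearMap.fst F (Fin ℓ → F) C₂).prod (g.coprod h) :=
    funext fun ω => Prod.ext rfl (congrFun hY ω)
  have hX : (fun ω : (Fin ℓ → F) × C₂ => ω.1) = LinearMap.fst F (Fin ℓ → F) C₂ := rfl
  have hh : LinearMap.range h = C₂.map R := by
    rw [LinearMap.range_comp, Submodule.range_subtype]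
  have hgh : LinearMap.range (g.coprod h) = C₁.map R := by
    rw [LinearMap.range_coprod, hh, LinearMap.range_comp, LinearMap.range_comp,
      LinearEquiv.range, Submodule.map_top, Submodule.range_subtype, ← Submodule.map_sup,
      sup_comm, hWsup]
  have h₁ := finrank_map_mulRight_add_finrank_traceDual_inf_rss C₁ B
  have h₂ := finrank_map_mulRight_add_finrank_traceDual_inf_rss C₂ B
  have hdim : (Module.finrank F (C₁.map R) : ℝ) - Module.finrank F (C₂.map R) =
      Module.finrank F ↥(traceDual C₂ ⊓ rss m (rowSpace B)) -
        Module.finrank F ↥(traceDual C₁ ⊓ rss m (rowSpace B)) := by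
    rw [sub_eq_sub_iff_add_eq_add, add_comm (Module.finrank F _ : ℝ) (Module.finrank F (C₂.map R))]
    exact_mod_cast h₁.trans h₂.symm
  rw [mutualInfo, hY, hXY, hX, entropy_linearMap, entropy_linearMap, entropy_linearMap,
    finrank_range_fst_prod_coprod, LinearMap.range_eq_top.2 LinearMap.fst_surjective,
    finrank_top, hh, hgh, ← hdim]
  push_cast
  ring

end
end

section
/- Let F be a field and m ≠ n positive integers. If φ : F^{m×n} → F^{m×n} is a vector space isomorphism satisfying Rk(φ(C)) = Rk(C) for all C ∈ F^{m×n} (a rank isometry), then there exist invertible matrices A ∈ F^{m×m} and B ∈ F^{n×n} such that φ(C) = ACB for all C ∈ F^{m×n}. -/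
noncomputable section

open Matrix

variable {F : Type*} [Field F]

section RankOne

variable {ι κ : Type*}

/-- If a nonzero rank one matrix `a bᵀ` and a matrix `a' b'ᵀ` have a sum of rank at most one,
then they share the column space or the row space. -/
theorem vecMulVec_eq_or_eq_of_add_eq {a a' c : ι → F} {b b' d : κ → F}
    (h : vecMulVec a b + vecMulVec a' b' = vecMulVec c d) (h0 : vecMulVec a b ≠ 0) :
    (∃ w, vecMulVec a' b' = vecMulVec a w) ∨ ∃ w, vecMulVec a' b' = vecMulVec w b := by
  have ha : a ≠ 0 := by rintro rfl; simp at h0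
  have hb : b ≠ 0 := by rintro rfl; exact h0 (by ext; simp [vecMulVec_apply])
  obtain ⟨i, hi⟩ := Function.ne_iff.mp ha
  obtain ⟨j, hj⟩ := Function.ne_iff.mp hb
  simp only [Pi.zero_apply] at hi hj
  have e (p : ι) (q : κ) : a p * b q + a' p * b' q = c p * d q := by
    simpa [vecMulVec_apply] using congrFun (congrFun h p) q
  have minor (k : ι) (l : κ) : (a i * a' k - a k * a' i) * (b j * b' l - b l * b' j) = 0 := by
    linear_combination (a k * b l + a' k * b' l) * e i j + c i * d j * e k l
      - (a k * b j + a' k * b' j) * e i l - c i * d l * e k j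
  by_cases hk : ∀ k, a i * a' k - a k * a' i = 0
  · refine Or.inl ⟨((a i)⁻¹ * a' i) • b', ?_⟩
    ext k l
    simp only [vecMulVec_apply, Pi.smul_apply, smul_eq_mul]
    field_simp
    linear_combination b' l * hk k
  · push Not at hk
    obtain ⟨k, hk⟩ := hk
    refine Or.inr ⟨((b j)⁻¹ * b' j) • a', ?_⟩
    ext p l
    have hl := (mul_eq_zero.mp (minor k l)).resolve_left hk
    simp only [vecMulVec_apply, Pi.smul_apply, smul_eq_mul]
    field_simp
    linear_combination a' p * hl

/-- A linear space of matrices of rank at most one has a common column or a common row. -/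
theorem exists_forall_eq_vecMulVec {V : Type*} [AddCommGroup V] [Module F V]
    (f : V →ₗ[F] Matrix ι κ F) (hf : ∀ v, ∃ a b, f v = vecMulVec a b) :
    (∃ a, ∀ v, ∃ b, f v = vecMulVec a b) ∨ ∃ b, ∀ v, ∃ a, f v = vecMulVec a b := by
  by_cases hz : ∀ v, f v = 0
  · exact Or.inl ⟨0, fun v => ⟨0, by simp [hz]⟩⟩
  push Not at hz
  obtain ⟨v₀, hv₀⟩ := hz
  obtain ⟨a, b, hab⟩ := hf v₀
  have key (v : V) : (∃ w, f v = vecMulVec a w) ∨ ∃ w, f v = vecMulVec w b := by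
    obtain ⟨a', b', h'⟩ := hf v
    obtain ⟨c, d, hcd⟩ := hf (v₀ + v)
    rw [h']
    exact vecMulVec_eq_or_eq_of_add_eq (by rw [← hcd, map_add, hab, h']) (hab ▸ hv₀)
  by_contra! hcon
  obtain ⟨x, hx⟩ := hcon.1 a
  obtain ⟨y, hy⟩ := hcon.2 b
  obtain ⟨s, hs⟩ := (key x).resolve_left fun ⟨w, hw⟩ => hx w hw
  obtain ⟨t, ht⟩ := (key y).resolve_right fun ⟨w, hw⟩ => hy w hw
  rcases key (x + y) with ⟨w, hw⟩ | ⟨w, hw⟩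
  · refine hx (w - t) ?_
    rw [vecMulVec_sub, ← hw, ← ht, map_add, add_sub_cancel_right]
  · refine hy (w - s) ?_
    rw [sub_vecMulVec, ← hw, ← hs, map_add, add_sub_cancel_left]

variable [Fintype ι] [Fintype κ] [DecidableEq κ]

/-- An injective linear map from `κ → F` to matrices of rank at most one with fewer rows than
columns is of the form `v ↦ a (N v)ᵀ` with `N` invertible. -/
theorem exists_isUnit_forall_eq_vecMulVec (hcard : Fintype.card ι < Fintype.card κ)
    (f : (κ → F) →ₗ[F] Matrix ι κ F) (hinj : Function.Injective f)
    (hf : ∀ v, ∃ a b, f v = vecMulVec a b) :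
    ∃ (a : ι → F) (N : Matrix κ κ F), IsUnit N ∧ ∀ v, f v = vecMulVec a (N *ᵥ v) := by
  rcases exists_forall_eq_vecMulVec f hf with ⟨a, ha⟩ | ⟨b, hb⟩
  · have : Nonempty κ := Fintype.card_pos_iff.mp (by omega)
    have ha0 : a ≠ 0 := by
      rintro rfl
      obtain ⟨b, hb⟩ := ha 1
      rw [zero_vecMulVec, map_eq_zero_iff f hinj] at hb
      exact one_ne_zero hb
    obtain ⟨i, hi⟩ := Function.ne_iff.mp ha0
    simp only [Pi.zero_apply] at hi
    let g : (κ → F) →ₗ[F] (κ → F) := (a i)⁻¹ • (LinearMap.proj i).comp f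
    have hg (v : κ → F) : f v = vecMulVec a (g v) := by
      obtain ⟨b, hb⟩ := ha v
      have : g v = b := by
        ext j
        change (a i)⁻¹ * f v i j = b j
        rw [hb, vecMulVec_apply]
        field_simp
      rw [this, hb]
    refine ⟨a, LinearMap.toMatrix' g, ?_, fun v => by rw [LinearMap.toMatrix'_mulVec, hg]⟩
    rw [← mulVec_injective_iff_isUnit]
    intro v w hvw
    simp only [LinearMap.toMatrix'_mulVec] at hvw
    exact hinj (by rw [hg, hg, hvw])
  · exfalso
    let R : (ι → F) →ₗ[F] Matrix ι κ F := (vecMulVecBilin F F).flip b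
    have hle : LinearMap.range f ≤ LinearMap.range R := by
      rintro _ ⟨v, rfl⟩
      obtain ⟨a, ha⟩ := hb v
      exact ⟨a, ha.symm⟩
    have h₁ := Submodule.finrank_mono hle
    have h₂ := LinearMap.finrank_range_le R
    rw [LinearMap.finrank_range_of_inj hinj] at h₁
    simp only [Module.finrank_fintype_fun_eq_card] at h₁ h₂
    omega

/-- An injective linear endomorphism of the matrices with fewer rows than columns that preserves
rank at most one is of the form `C ↦ A C B` with `A` and `B` invertible. -/
theorem exists_isUnit_mul_mul_of_card_lt [DecidableEq ι] [Nonempty ι]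
    (hcard : Fintype.card ι < Fintype.card κ)
    (φ : Matrix ι κ F →ₗ[F] Matrix ι κ F) (hinj : Function.Injective φ)
    (hφ : ∀ u v, ∃ a b, φ (vecMulVec u v) = vecMulVec a b) :
    ∃ (A : Matrix ι ι F) (B : Matrix κ κ F), IsUnit A ∧ IsUnit B ∧ ∀ C, φ C = A * C * B := by
  have : Nonempty κ := Fintype.card_pos_iff.mp (by omega)
  let u₀ : ι → F := 1
  obtain ⟨a₀, N, hN, ha₀⟩ := exists_isUnit_forall_eq_vecMulVec hcard
    (φ.comp (vecMulVecBilin F F u₀))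
    (hinj.comp fun v w hvw => funext fun j => by
      simpa [vecMulVec_apply, u₀] using congrFun (congrFun hvw (Classical.arbitrary ι)) j)
    (fun v => hφ u₀ v)
  replace ha₀ (v : κ → F) : φ (vecMulVec u₀ v) = vecMulVec a₀ (N *ᵥ v) := ha₀ v
  have key (u : ι → F) (v : κ → F) : ∃ w, φ (vecMulVec u v) = vecMulVec w (N *ᵥ v) := by
    rcases eq_or_ne v 0 with rfl | hv
    · have h : vecMulVec u (0 : κ → F) = 0 := by ext; simp [vecMulVec_apply]
      exact ⟨0, by simp [h]⟩
    obtain ⟨a, b, hab⟩ := hφ u v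
    obtain ⟨c, d, hcd⟩ := hφ (u₀ + u) v
    have hne : vecMulVec u₀ v ≠ 0 := fun h => hv <| funext fun j => by
      simpa [vecMulVec_apply, u₀] using congrFun (congrFun h (Classical.arbitrary ι)) j
    rcases vecMulVec_eq_or_eq_of_add_eq (a := a₀) (b := N *ᵥ v) (a' := a) (b' := b)
      (by rw [← hcd, add_vecMulVec, map_add, ha₀, hab])
      (by rw [← ha₀, Ne, map_eq_zero_iff φ hinj]; exact hne) with ⟨w, hw⟩ | ⟨w, hw⟩
    · obtain ⟨v', rfl⟩ := (mulVec_surjective_iff_isUnit.mpr hN) w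
      have huv : vecMulVec u v = vecMulVec u₀ v' := hinj (by rw [hab, hw, ha₀])
      obtain ⟨j, hj⟩ := Function.ne_iff.mp hv
      simp only [Pi.zero_apply] at hj
      have hu : u = (v' j / v j) • u₀ := by
        ext i
        have := congrFun (congrFun huv i) j
        simp only [vecMulVec_apply] at this
        simp only [Pi.smul_apply, smul_eq_mul]
        field_simp
        linear_combination this
      exact ⟨(v' j / v j) • a₀, by rw [hu, smul_vecMulVec, map_smul, ha₀, smul_vecMulVec]⟩
    · exact ⟨w, hab.trans hw⟩
  obtain ⟨M, hMN⟩ : ∃ M, M * N = 1 := ⟨N⁻¹, nonsing_inv_mul N ((isUnit_iff_isUnit_det N).mp hN)⟩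
  have col (u : ι → F) : ∃ w, ∀ v, φ (vecMulVec u v) = vecMulVec w (N *ᵥ v) := by
    let ψ : (κ → F) →ₗ[F] Matrix ι κ F :=
      (mulRightLinearMap ι F Mᵀ).comp (φ.comp (vecMulVecBilin F F u))
    have hψ (v : κ → F) : ∃ w, ψ v = vecMulVec w v := by
      obtain ⟨w, hw⟩ := key u v
      refine ⟨w, ?_⟩
      change φ (vecMulVec u v) * Mᵀ = _
      rw [hw, vecMulVec_mul, vecMul_transpose, mulVec_mulVec, hMN, one_mulVec]
    obtain ⟨w, hw⟩ := hψ 1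
    have hsingle (j : κ) : ψ (Pi.single j 1) = vecMulVec w (Pi.single j 1) := by
      choose x hx using fun k : κ => hψ (Pi.single k 1)
      have h1 : (1 : κ → F) = ∑ k, Pi.single k 1 := (Finset.univ_sum_single (1 : κ → F)).symm
      have hxw : x j = w := by
        ext i
        have := congrFun (congrFun hw i) j
        rw [h1, map_sum, ← h1] at this
        simpa [hx, Matrix.sum_apply, vecMulVec_apply, Pi.single_apply] using this
      rw [hx, hxw]
    have hψw : ψ = vecMulVecBilin F F w := by
      refine LinearMap.pi_ext' fun j => LinearMap.ext_ring ?_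
      exact hsingle j
    refine ⟨w, fun v => ?_⟩
    have h : φ (vecMulVec u v) * Mᵀ = vecMulVec w v := LinearMap.congr_fun hψw v
    calc φ (vecMulVec u v) = φ (vecMulVec u v) * Mᵀ * Nᵀ := by
          rw [Matrix.mul_assoc, ← transpose_mul, mul_eq_one_comm.mp hMN, transpose_one,
            Matrix.mul_one]
      _ = vecMulVec w (N *ᵥ v) := by rw [h, vecMulVec_mul, vecMul_transpose]
  choose α hα using fun i : ι => col (Pi.single i 1)
  let A : Matrix ι ι F := (of α)ᵀ
  have hφA : φ = (mulRightLinearMap ι F Nᵀ).comp (mulLeftLinearMap κ F A) := by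
    refine Matrix.ext_linearMap F fun i j => LinearMap.ext_ring ?_
    change φ (single i j (1 : F)) = A * single i j (1 : F) * Nᵀ
    rw [single_eq_single_vecMulVec_single, hα, mul_vecMulVec, vecMulVec_mul, vecMul_transpose,
      mulVec_single_one, mulVec_single_one]
    rfl
  replace hφA (C : Matrix ι κ F) : φ C = A * C * Nᵀ := LinearMap.congr_fun hφA C
  refine ⟨A, Nᵀ, ?_, (isUnit_transpose N).mpr hN, hφA⟩
  rw [← mulVec_injective_iff_isUnit]
  intro x y hxy
  have : vecMulVec x (1 : κ → F) = vecMulVec y 1 := hinj (by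
    rw [hφA, hφA, mul_vecMulVec, mul_vecMulVec]; exact congrArg (vecMulVec · 1 * Nᵀ) hxy)
  ext i
  simpa [vecMulVec_apply] using congrFun (congrFun this i) (Classical.arbitrary κ)

end RankOne

theorem Rk_vecMulVec_le {m n : ℕ} (u : Fin m → F) (v : Fin n → F) : Rk (vecMulVec u v) ≤ 1 := by
  have hle : rowSpace (vecMulVec u v) ≤ Submodule.span F {v} := by
    rw [rowSpace, Submodule.span_le]
    rintro _ ⟨i, rfl⟩
    exact Submodule.mem_span_singleton.mpr ⟨u i, rfl⟩
  exact (Submodule.finrank_mono hle).trans ((finrank_span_le_card _).trans (by simp))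

theorem exists_eq_vecMulVec_of_Rk_le_one {m n : ℕ} {C : Matrix (Fin m) (Fin n) F}
    (h : Rk C ≤ 1) : ∃ a b, C = vecMulVec a b := by
  obtain ⟨⟨b, _⟩, hb⟩ := finrank_le_one_iff.mp h
  choose a ha using fun i => hb ⟨C i, Submodule.subset_span ⟨i, rfl⟩⟩
  refine ⟨a, b, ?_⟩
  ext i j
  exact (congrFun (congrArg Subtype.val (ha i)) j).symm

/-- For `m ≠ n`, every rank isometry `φ : F^{m×n} → F^{m×n}` is of the form
`φ(C) = A C B` for invertible matrices `A ∈ F^{m×m}` and `B ∈ F^{n×n}`. -/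
theorem stmt_14 (m n : ℕ) (hm : 0 < m) (hn : 0 < n) (hmn : m ≠ n)
    (φ : Matrix (Fin m) (Fin n) F ≃ₗ[F] Matrix (Fin m) (Fin n) F)
    (hφ : ∀ C : Matrix (Fin m) (Fin n) F, Rk (φ C) = Rk C) :
    ∃ (A : Matrix (Fin m) (Fin m) F) (B : Matrix (Fin n) (Fin n) F),
      IsUnit A ∧ IsUnit B ∧ ∀ C : Matrix (Fin m) (Fin n) F, φ C = A * C * B := by
  have hone (u : Fin m → F) (v : Fin n → F) : ∃ a b, φ (vecMulVec u v) = vecMulVec a b :=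
    exists_eq_vecMulVec_of_Rk_le_one ((hφ _).trans_le (Rk_vecMulVec_le u v))
  have : Nonempty (Fin m) := ⟨⟨0, hm⟩⟩
  have : Nonempty (Fin n) := ⟨⟨0, hn⟩⟩
  rcases hmn.lt_or_gt with h | h
  · exact exists_isUnit_mul_mul_of_card_lt (by simpa using h) φ.toLinearMap φ.injective hone
  · let τ := transposeLinearEquiv (Fin m) (Fin n) F F
    let ψ := (τ.symm.trans φ).trans τ
    obtain ⟨A, B, hA, hB, hAB⟩ := exists_isUnit_mul_mul_of_card_lt (by simpa using h)
      ψ.toLinearMap ψ.injective (fun u v => by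
        obtain ⟨a, b, hab⟩ := hone v u
        refine ⟨b, a, ?_⟩
        change (φ (vecMulVec u v)ᵀ)ᵀ = _
        rw [transpose_vecMulVec, hab, transpose_vecMulVec])
    refine ⟨Bᵀ, Aᵀ, (isUnit_transpose B).mpr hB, (isUnit_transpose A).mpr hA, fun C => ?_⟩
    have hC : (φ C)ᵀ = A * Cᵀ * B := hAB Cᵀ
    rw [← transpose_transpose (φ C), hC, transpose_mul, transpose_mul, transpose_transpose,
      Matrix.mul_assoc]

end
end

section
/- Let F be a field, D ⊆ F^n a subspace, I ⊆ {1,…,n} a subset, and J = HSupp(D). Then: (1) RSupp(Δ(D)) = L_J ⊆ F^n; (2) if V ⊆ F^{n×n} is a rank support space such that Δ(D) = V ∩ Δ(F^n), then D = L_J; (3) wt_R(Δ(D)) = wt_H(D). -/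
noncomputable section

open Matrix

variable {F : Type*} [Field F]

/-- The diagonal representation map `Δ : F^n → F^{n×n}`, as a linear map. -/
def diagLin {n : ℕ} : (Fin n → F) →ₗ[F] Matrix (Fin n) (Fin n) F where
  toFun := Matrix.diagonal
  map_add' a b := by
    ext i j
    by_cases h : i = j <;> simp [Matrix.diagonal_apply, Matrix.add_apply, h]
  map_smul' r a := by
    ext i j
    by_cases h : i = j <;> simp [Matrix.diagonal_apply, Matrix.smul_apply, h]

/-- The Hamming support of a subspace `D ⊆ F^n`. -/
def HSupp {n : ℕ} (D : Submodule F (Fin n → F)) : Set (Fin n) :=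
  {i | ∃ c ∈ D, c i ≠ 0}

/-- The Hamming weight of a subspace `D ⊆ F^n`. -/
def wtH {n : ℕ} (D : Submodule F (Fin n → F)) : ℕ :=
  (HSupp D).ncard

/-- The Hamming support space of a subset `I ⊆ {1, …, n}`. -/
def LI {n : ℕ} (I : Set (Fin n)) : Submodule F (Fin n → F) where
  carrier := {c | ∀ i ∉ I, c i = 0}
  add_mem' := by
    intro a b ha hb i hi
    simp [Pi.add_apply, ha i hi, hb i hi]
  zero_mem' := by
    intro i hi
    rfl
  smul_mem' := by
    intro c a ha i hi
    simp [Pi.smul_apply, ha i hi]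

theorem rowSpace_diagLin_le_iff {n : ℕ} {c : Fin n → F} {L : Submodule F (Fin n → F)} :
    rowSpace (diagLin c) ≤ L ↔ ∀ i, c i ≠ 0 → Pi.single i 1 ∈ L := by
  have row_eq (i : Fin n) : diagLin c i = c i • (Pi.single i 1 : Fin n → F) := by
    ext j
    rcases eq_or_ne j i with rfl | h
    · simp [diagLin]
    · simp [diagLin, diagonal_apply_ne' c h, h]
  refine (Submodule.span_le.trans Set.range_subset_iff).trans (forall_congr' fun i => ?_)
  rw [SetLike.mem_coe, row_eq]
  by_cases h : c i = 0
  · simp [h]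
  · simp [h, L.smul_mem_iff h]

theorem LI_eq_spanSubset {n : ℕ} (I : Set (Fin n)) : LI I = Pi.spanSubset F I := by
  ext c
  exact Pi.mem_spanSubset_iff.symm

theorem LI_le_iff {n : ℕ} {I : Set (Fin n)} {L : Submodule F (Fin n → F)} :
    LI I ≤ L ↔ ∀ i ∈ I, Pi.single i 1 ∈ L := by
  simp [LI_eq_spanSubset, Pi.spanSubset, Submodule.span_le, Set.subset_def]

theorem RSupp_map_diagLin_le_iff {n : ℕ} {D L : Submodule F (Fin n → F)} :
    RSupp (D.map diagLin) ≤ L ↔ ∀ c ∈ D, rowSpace (diagLin c) ≤ L := by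
  simp [RSupp, iSup_le_iff]

theorem RSupp_map_diagLin {n : ℕ} (D : Submodule F (Fin n → F)) :
    RSupp (D.map diagLin) = LI (HSupp D) := by
  refine eq_of_forall_ge_iff fun L => ?_
  simp only [RSupp_map_diagLin_le_iff, rowSpace_diagLin_le_iff, LI_le_iff, HSupp,
    Set.mem_ofPred_eq]
  exact ⟨fun h i ⟨c, hc, hi⟩ => h c hc i hi, fun h c hc i hi => h i ⟨c, hc, hi⟩⟩

theorem finrank_LI {n : ℕ} (I : Set (Fin n)) :
    Module.finrank F (LI I : Submodule F (Fin n → F)) = I.ncard := by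
  rw [LI_eq_spanSubset, Pi.dim_spanSubset]

theorem le_LI_HSupp {n : ℕ} (D : Submodule F (Fin n → F)) : D ≤ LI (HSupp D) :=
  fun c hc _ hi => by_contra fun h => hi ⟨c, hc, h⟩

/-- For a subspace `D ⊆ F^n` with `J = HSupp(D)`:
(1) `RSupp(Δ(D)) = L_J`; (2) if `V` is a rank support space with `Δ(D) = V ∩ Δ(F^n)`, then
`D = L_J`; (3) `wt_R(Δ(D)) = wt_H(D)`. -/
theorem stmt_18 (n : ℕ) (D : Submodule F (Fin n → F)) (I : Set (Fin n)) :
    RSupp (Submodule.map (diagLin (F := F) (n := n)) D) = LI (HSupp D) ∧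
    (∀ V : Submodule F (Matrix (Fin n) (Fin n) F), IsRSS V →
      Submodule.map (diagLin (F := F) (n := n)) D =
        V ⊓ LinearMap.range (diagLin (F := F) (n := n)) →
      D = LI (HSupp D)) ∧
    wtR (Submodule.map (diagLin (F := F) (n := n)) D) = wtH D := by
  refine ⟨RSupp_map_diagLin D, ?_, by rw [wtR, RSupp_map_diagLin, finrank_LI, wtH]⟩
  rintro V ⟨L, rfl⟩ hV
  refine le_antisymm (le_LI_HSupp D) fun c hc => ?_
  have hL : LI (HSupp D) ≤ L := by
    rw [← RSupp_map_diagLin, RSupp_map_diagLin_le_iff]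
    intro d hd
    exact (hV.le (Submodule.mem_map_of_mem hd)).1
  have hcL : rowSpace (diagLin c) ≤ L :=
    rowSpace_diagLin_le_iff.2 fun i hi => LI_le_iff.1 hL i (by_contra fun h => hi (hc i h))
  obtain ⟨d, hd, hdc⟩ := hV.ge ⟨hcL, LinearMap.mem_range_self diagLin c⟩
  rwa [← diagonal_injective hdc]

end
end
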